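/- Let F_1, …, F_U : E → ℝ (U ≥ 1) each be differentiable, convex, and L-smooth (L > 0), define the global objective F(w) = (1/U)∑_{u=1}^U F_u(w), let θ* be a minimizer of F, and assume (1/U)∑_{u=1}^U ‖∇F_u(θ*)‖² ≤ σ*². Fix θ ∈ E, τ ≥ 1, and points x_{u,k} ∈ E (u = 1, …, U, k = 0, …, τ−1), and define the aggregate client gradients r_u = ∑_{k=0}^{τ−1} ∇F_u(x_{u,k}). Then (1/U)·∑_{u=1}^U ‖r_u‖² ≤ (3τL²/U)·∑_{u=1}^U ∑_{k=0}^{τ−1} ‖x_{u,k} − θ‖² + 6τ²L·(F(θ) − F(θ*)) + 3τ²σ*². -/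

import Mathlib

open RealInnerProductSpace

section Smooth

variable {E : Type*} [NormedAddCommGroup E] [InnerProductSpace ℝ E] [CompleteSpace E]
  {f : E → ℝ} {L : ℝ}

lemma Differentiable.hasDerivAt_comp_lineMap (hf : Differentiable ℝ f) (x y : E) (t : ℝ) :
    HasDerivAt (fun s : ℝ => f (AffineMap.lineMap x y s))
      ⟪gradient f (AffineMap.lineMap x y t), y - x⟫ t := by
  have h := (hf (AffineMap.lineMap x y t)).hasGradientAt.hasFDerivAt.comp_hasDerivAt t
    (AffineMap.hasDerivAt_lineMap (a := x) (b := y) (x := t))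
  simpa [Function.comp_def, InnerProductSpace.toDual_apply_apply] using h

/-- A differentiable convex function lies above its tangent planes. -/
lemma ConvexOn.add_inner_gradient_le (hc : ConvexOn ℝ Set.univ f) (hf : Differentiable ℝ f)
    (x y : E) : f x + ⟪gradient f x, y - x⟫ ≤ f y := by
  have hline : ConvexOn ℝ Set.univ (fun s : ℝ => f (AffineMap.lineMap x y s)) := by
    simpa [Function.comp_def] using hc.comp_affineMap (AffineMap.lineMap x y : ℝ →ᵃ[ℝ] E)
  have h := hline.le_slope_of_hasDerivAt (Set.mem_univ 0) (Set.mem_univ 1) one_pos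
    (hf.hasDerivAt_comp_lineMap x y 0)
  simp only [slope_def_field, AffineMap.lineMap_apply_zero, AffineMap.lineMap_apply_one, sub_zero,
    div_one] at h
  linarith

/-- The descent lemma: a function with `L`-Lipschitz gradient lies below a quadratic. -/
lemma le_add_inner_gradient_add_sq (hf : Differentiable ℝ f)
    (hL : ∀ x y : E, ‖gradient f x - gradient f y‖ ≤ L * ‖x - y‖) (x y : E) :
    f y ≤ f x + ⟪gradient f x, y - x⟫ + L / 2 * ‖y - x‖ ^ 2 := by
  set φ : ℝ → ℝ := fun t => f (AffineMap.lineMap x y t) - t * ⟪gradient f x, y - x⟫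
    - L / 2 * ‖y - x‖ ^ 2 * t ^ 2 with hφ
  have hd (t : ℝ) : HasDerivAt φ (⟪gradient f (AffineMap.lineMap x y t), y - x⟫
      - ⟪gradient f x, y - x⟫ - L * ‖y - x‖ ^ 2 * t) t := by
    have h := ((hf.hasDerivAt_comp_lineMap x y t).sub
      ((hasDerivAt_id t).mul_const ⟪gradient f x, y - x⟫)).sub
      ((hasDerivAt_pow 2 t).const_mul (L / 2 * ‖y - x‖ ^ 2))
    refine h.congr_deriv ?_
    push_cast
    ring
  have hanti : AntitoneOn φ (Set.Icc 0 1) := by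
    refine antitoneOn_of_deriv_nonpos (convex_Icc 0 1)
      (fun t _ => (hd t).continuousAt.continuousWithinAt)
      (fun t _ => (hd t).differentiableAt.differentiableWithinAt) fun t ht => ?_
    rw [interior_Icc] at ht
    rw [(hd t).deriv, ← inner_sub_left]
    have h1 := real_inner_le_norm (gradient f (AffineMap.lineMap x y t) - gradient f x) (y - x)
    have h2 := hL (AffineMap.lineMap x y t) x
    have h3 : ‖(AffineMap.lineMap x y t : E) - x‖ = t * ‖y - x‖ := by
      rw [AffineMap.lineMap_apply_module', add_sub_cancel_right, norm_smul,
        Real.norm_of_nonneg ht.1.le]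
    rw [h3] at h2
    have h4 := mul_le_mul_of_nonneg_right h2 (norm_nonneg (y - x))
    nlinarith
  have h := hanti (Set.left_mem_Icc.2 zero_le_one) (Set.right_mem_Icc.2 zero_le_one) zero_le_one
  simp only [hφ, AffineMap.lineMap_apply_zero, AffineMap.lineMap_apply_one] at h
  linarith

/-- The gradient gap of a convex `L`-smooth function is bounded by its Bregman divergence. -/
lemma ConvexOn.norm_gradient_sub_sq_le (hc : ConvexOn ℝ Set.univ f) (hf : Differentiable ℝ f)
    (hpos : 0 < L) (hL : ∀ x y : E, ‖gradient f x - gradient f y‖ ≤ L * ‖x - y‖) (x y : E) :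
    ‖gradient f x - gradient f y‖ ^ 2 ≤ 2 * L * (f x - f y - ⟪gradient f y, x - y⟫) := by
  set d := gradient f x - gradient f y with hd
  have h1 := hc.add_inner_gradient_le hf y (x - L⁻¹ • d)
  have h2 := le_add_inner_gradient_add_sq hf hL x (x - L⁻¹ • d)
  rw [sub_right_comm, inner_sub_right, inner_smul_right] at h1
  rw [sub_sub_cancel_left, norm_neg, inner_neg_right, inner_smul_right, norm_smul,
    Real.norm_of_nonneg (inv_pos.2 hpos).le] at h2
  have h3 : ⟪gradient f x, d⟫ - ⟪gradient f y, d⟫ = ‖d‖ ^ 2 := by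
    rw [← inner_sub_left, ← hd, real_inner_self_eq_norm_sq]
  have h4 : L⁻¹ * ‖d‖ ^ 2 - L / 2 * (L⁻¹ * ‖d‖) ^ 2 = ‖d‖ ^ 2 / (2 * L) := by
    field_simp
    ring
  have h5 : ‖d‖ ^ 2 / (2 * L) ≤ f x - f y - ⟪gradient f y, x - y⟫ := by
    rw [← h4, ← h3]
    linarith
  rwa [div_le_iff₀' (by positivity)] at h5

lemma sum_inner_gradient_eq_zero_of_isMinOn {ι : Type*} [Fintype ι] {F : ι → E → ℝ}
    (hF : ∀ u, Differentiable ℝ (F u)) {a : E} (ha : ∀ w, ∑ u, F u a ≤ ∑ u, F u w) (v : E) :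
    ∑ u, ⟪gradient (F u) a, v⟫ = 0 := by
  have hd := HasFDerivAt.fun_sum (u := Finset.univ)
    fun u _ => (hF u a).hasGradientAt.hasFDerivAt
  have hmin : IsLocalMin (fun w => ∑ u, F u w) a := Filter.Eventually.of_forall ha
  have h := DFunLike.congr_fun (hmin.hasFDerivAt_eq_zero hd) v
  simpa [InnerProductSpace.toDual_apply_apply] using h

end Smooth

lemma norm_sum_sq_le_card_mul_sum_norm_sq {ι E : Type*} [SeminormedAddCommGroup E]
    (s : Finset ι) (g : ι → E) : ‖∑ i ∈ s, g i‖ ^ 2 ≤ s.card * ∑ i ∈ s, ‖g i‖ ^ 2 :=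
  (pow_le_pow_left₀ (norm_nonneg _) (norm_sum_le s g) 2).trans sq_sum_le_card_mul_sum_sq

lemma norm_sq_le_three_mul_of_sub_sub {E : Type*} [SeminormedAddCommGroup E] (a b c : E) :
    ‖a‖ ^ 2 ≤ 3 * (‖a - b‖ ^ 2 + ‖b - c‖ ^ 2 + ‖c‖ ^ 2) := by
  have h1 := norm_add₃_le (a := a - b) (b := b - c) (c := c)
  rw [sub_add_sub_cancel, sub_add_cancel] at h1
  have h2 := pow_le_pow_left₀ (norm_nonneg a) h1 2
  nlinarith [sq_nonneg (‖a - b‖ - ‖b - c‖), sq_nonneg (‖b - c‖ - ‖c‖), sq_nonneg (‖a - b‖ - ‖c‖)]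

/-- Bound A2: the average of the squared norms of the aggregate client gradients
`r_u = ∑_k ∇F_u(x_{u,k})` is bounded by the client drift, the global objective gap and the
heterogeneity at the optimum. -/
theorem aggregate_grad_sq_bound {E : Type*} [NormedAddCommGroup E]
    [InnerProductSpace ℝ E] [CompleteSpace E]
    (U : ℕ) (hU : 1 ≤ U) (F : Fin U → E → ℝ) (L : ℝ) (hL : 0 < L)
    (hdiff : ∀ u, Differentiable ℝ (F u))
    (hconv : ∀ u, ConvexOn ℝ Set.univ (F u))
    (hsmooth : ∀ u, ∀ x y : E, ‖gradient (F u) x - gradient (F u) y‖ ≤ L * ‖x - y‖)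
    (Fglob : E → ℝ) (hFglob : ∀ w : E, Fglob w = (1 / (U : ℝ)) * ∑ u : Fin U, F u w)
    (θstar : E) (hmin : ∀ θ : E, Fglob θstar ≤ Fglob θ)
    (σstar : ℝ)
    (hhet : (1 / (U : ℝ)) * ∑ u : Fin U, ‖gradient (F u) θstar‖ ^ 2 ≤ σstar ^ 2)
    (θ : E) (τ : ℕ) (hτ : 1 ≤ τ) (x : Fin U → ℕ → E)
    (r : Fin U → E)
    (hr : ∀ u, r u = ∑ k ∈ Finset.range τ, gradient (F u) (x u k)) :
    (1 / (U : ℝ)) * ∑ u : Fin U, ‖r u‖ ^ 2 ≤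
      (3 * (τ : ℝ) * L ^ 2 / (U : ℝ)) * ∑ u : Fin U, ∑ k ∈ Finset.range τ, ‖x u k - θ‖ ^ 2 +
        6 * (τ : ℝ) ^ 2 * L * (Fglob θ - Fglob θstar) + 3 * (τ : ℝ) ^ 2 * σstar ^ 2 := by
  have hU0 : (0 : ℝ) < U := by exact_mod_cast hU
  have hr_le (u : Fin U) : ‖r u‖ ^ 2 ≤ 3 * τ * L ^ 2 * ∑ k ∈ Finset.range τ, ‖x u k - θ‖ ^ 2
      + 6 * (τ : ℝ) ^ 2 * L * (F u θ - F u θstar - ⟪gradient (F u) θstar, θ - θstar⟫)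
      + 3 * (τ : ℝ) ^ 2 * ‖gradient (F u) θstar‖ ^ 2 := by
    have hterm : ∀ k ∈ Finset.range τ, ‖gradient (F u) (x u k)‖ ^ 2 ≤
        3 * L ^ 2 * ‖x u k - θ‖ ^ 2
        + (6 * L * (F u θ - F u θstar - ⟪gradient (F u) θstar, θ - θstar⟫)
          + 3 * ‖gradient (F u) θstar‖ ^ 2) := fun k _ => by
      have h1 := norm_sq_le_three_mul_of_sub_sub (gradient (F u) (x u k)) (gradient (F u) θ)
        (gradient (F u) θstar)
      have h2 := pow_le_pow_left₀ (norm_nonneg _) (hsmooth u (x u k) θ) 2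
      have h3 := (hconv u).norm_gradient_sub_sq_le (hdiff u) hL (hsmooth u) θ θstar
      rw [mul_pow] at h2
      linarith
    have h := Finset.sum_le_sum hterm
    rw [Finset.sum_add_distrib, ← Finset.mul_sum, Finset.sum_const, Finset.card_range,
      nsmul_eq_mul] at h
    have h' := norm_sum_sq_le_card_mul_sum_norm_sq (Finset.range τ)
      fun k => gradient (F u) (x u k)
    rw [← hr u, Finset.card_range] at h'
    linarith [mul_le_mul_of_nonneg_left h (Nat.cast_nonneg (α := ℝ) τ)]
  have hcrit := sum_inner_gradient_eq_zero_of_isMinOn hdiff (a := θstar) (fun w => by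
    have h := hmin w
    rw [hFglob, hFglob] at h
    exact le_of_mul_le_mul_left h (by positivity)) (θ - θstar)
  have hsum := Finset.sum_le_sum fun u (_ : u ∈ Finset.univ) => hr_le u
  simp only [Finset.sum_add_distrib, ← Finset.mul_sum, Finset.sum_sub_distrib, hcrit,
    sub_zero] at hsum
  have h := mul_le_mul_of_nonneg_left hsum (one_div_pos.2 hU0).le
  have hσ := mul_le_mul_of_nonneg_left hhet (by positivity : 0 ≤ 3 * (τ : ℝ) ^ 2)
  rw [hFglob, hFglob]
  calc _ ≤ _ := h
    _ = 3 * τ * L ^ 2 / U * ∑ u : Fin U, ∑ k ∈ Finset.range τ, ‖x u k - θ‖ ^ 2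
        + 6 * (τ : ℝ) ^ 2 * L * (1 / U * ∑ u, F u θ - 1 / U * ∑ u, F u θstar)
        + 3 * (τ : ℝ) ^ 2 * (1 / U * ∑ u, ‖gradient (F u) θstar‖ ^ 2) := by ring
    _ ≤ _ := by gcongr
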